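/- arXiv:2409.15500 — 4 statements merged into one kernel-verified Lean document; each statement's English description precedes it below -/
import Mathlib

section
/- Let x, y : [0,∞) → ℝ^d be continuous paths such that the difference x − y is differentiable with (x − y)'(t) = b(x(t)) − b(y(t)) + η·F(x(t)) for all t ≥ 0 (this is the evolution of the difference of two solutions of the SDEs dX = (b(X)+ηF(X))dt + √(2/β)dW and dY = b(Y)dt + √(2/β)dW driven by the same Brownian motion). Then for all t ≥ 0, |x(t) − y(t)| ≤ (|x(0) − y(0)| − |η|‖F‖∞/m)·e^{−m t} + |η|‖F‖∞/m. -/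
open scoped RealInnerProductSpace

/-- Differential inequality for the norm: if `⟪z, z'⟫ ≤ -m ‖z‖ ^ 2 + C ‖z‖` along a differentiable
curve `z`, then `‖z‖` is dominated by the solution of `r' = -m r + C` with the same initial
value. -/
theorem norm_le_of_inner_deriv_le {E : Type*} [NormedAddCommGroup E] [InnerProductSpace ℝ E]
    {z z' : ℝ → E} {m C : ℝ} (hm : 0 < m) (hC : 0 ≤ C)
    (hz : ∀ t, 0 ≤ t → HasDerivAt z (z' t) t)
    (hinner : ∀ t, 0 ≤ t → ⟪z t, z' t⟫ ≤ -m * ‖z t‖ ^ 2 + C * ‖z t‖) {t : ℝ} (ht : 0 ≤ t) :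
    ‖z t‖ ≤ (‖z 0‖ - C / m) * Real.exp (-m * t) + C / m := by
  refine le_of_forall_pos_le_add fun ε hε => ?_
  set G : ℝ → ℝ := fun s => (‖z 0‖ - C / m) * Real.exp (-m * s) + C / m + ε with hG
  have hG_deriv (s : ℝ) : HasDerivAt G (-m * G s + C + m * ε) s := by
    have h := (((((hasDerivAt_id s).const_mul (-m)).exp).const_mul
      (‖z 0‖ - C / m)).add_const (C / m)).add_const ε
    refine h.congr_deriv ?_
    simp only [hG, id]
    field_simp
    ring
  have hG_pos (s : ℝ) (hs : 0 ≤ s) : 0 < G s := by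
    have hexp : Real.exp (-m * s) ≤ 1 := Real.exp_le_one_iff.2 (by nlinarith)
    have h₁ : 0 ≤ ‖z 0‖ * Real.exp (-m * s) := by positivity
    have h₂ : 0 ≤ C / m * (1 - Real.exp (-m * s)) :=
      mul_nonneg (by positivity) (sub_nonneg.2 hexp)
    simp only [hG]
    linarith
  have hsq : ‖z t‖ ^ 2 ≤ G t ^ 2 := by
    refine image_le_of_deriv_right_lt_deriv_boundary (f := fun s => ‖z s‖ ^ 2)
      (B := fun s => G s ^ 2) (a := 0) (b := t)
      (fun s hs => (hz s hs.1).norm_sq.continuousAt.continuousWithinAt)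
      (fun s hs => (hz s hs.1).norm_sq.hasDerivWithinAt) ?_
      (fun s => (hG_deriv s).pow 2) ?_ ⟨ht, le_rfl⟩
    · refine pow_le_pow_left₀ (norm_nonneg _) ?_ 2
      simp [hG, hε.le]
    · intro s hs heq
      have hpos := hG_pos s hs.1
      have hnorm : ‖z s‖ = G s := (pow_left_inj₀ (norm_nonneg _) hpos.le two_ne_zero).1 heq
      have h := hinner s hs.1
      rw [hnorm] at h
      have : 0 < m * ε * G s := by positivity
      norm_num
      nlinarith
  exact (pow_le_pow_iff_left₀ (norm_nonneg _) (hG_pos t ht).le two_ne_zero).1 hsq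

/-- Synchronous-coupling distance bound: if the difference of two synchronously coupled
trajectories evolves by `(x − y)' = b(x) − b(y) + η F(x)`, with `b` globally contractive
with rate `m` and `‖F‖ ≤ Fb`, then
`‖x(t) − y(t)‖ ≤ (‖x(0) − y(0)‖ − |η| Fb / m) e^{−m t} + |η| Fb / m` for all `t ≥ 0`. -/
theorem synchronous_coupling_distance {d : ℕ}
    (b F : EuclideanSpace ℝ (Fin d) → EuclideanSpace ℝ (Fin d))
    (m : ℝ) (hm : 0 < m)
    (hcontr : ∀ u v : EuclideanSpace ℝ (Fin d),
      ⟪u - v, b u - b v⟫ ≤ -m * ‖u - v‖ ^ 2)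
    (Fb : ℝ) (hFb : ∀ z, ‖F z‖ ≤ Fb)
    (η : ℝ)
    (x y : ℝ → EuclideanSpace ℝ (Fin d))
    (hcx : Continuous x) (hcy : Continuous y)
    (hderiv : ∀ t : ℝ, 0 ≤ t → HasDerivAt (fun s => x s - y s)
      (b (x t) - b (y t) + η • F (x t)) t) :
    ∀ t : ℝ, 0 ≤ t →
      ‖x t - y t‖ ≤ (‖x 0 - y 0‖ - |η| * Fb / m) * Real.exp (-m * t)
        + |η| * Fb / m := by
  have hFb₀ : 0 ≤ Fb := (norm_nonneg _).trans (hFb 0)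
  intro t ht
  refine norm_le_of_inner_deriv_le (z := fun s => x s - y s) hm
    (mul_nonneg (abs_nonneg η) hFb₀) hderiv (fun s _ => ?_) ht
  rw [inner_add_right]
  refine add_le_add (hcontr _ _) ((real_inner_le_norm _ _).trans ?_)
  rw [norm_smul, Real.norm_eq_abs, mul_comm]
  gcongr
  exact hFb _
end

section
/- For every Δt ∈ (0, m/(2(L_b + η⋆L_F)²)), every η with |η| ≤ η⋆, and every x, x̃ ∈ ℝ^d with |x − x̃| ≥ M̃, one has |(x − x̃) + Δt·(b(x) − b(x̃) + η(F(x) − F(x̃)))|² ≤ (1 − mΔt/4)²·|x − x̃|². -/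
open scoped RealInnerProductSpace

/-- One-step contraction estimate for the Euler–Maruyama drift map at large distances:
if `b` is `L_b`-Lipschitz and contractive at infinity, `F` is `L_F`-Lipschitz and
uniformly bounded, and `|x − xtil| ≥ M̃ = max{M, 4 η⋆ ‖F‖∞ / m}`, then for time steps
`Δt ∈ (0, m/(2 (L_b + η⋆ L_F)²))` and `|η| ≤ η⋆`,
`‖(x − xtil) + Δt (b(x) − b(xtil) + η(F(x) − F(xtil)))‖² ≤ (1 − m Δt/4)² ‖x − xtil‖²`. -/
theorem euler_maruyama_one_step_contraction {d : ℕ}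
    (b F : EuclideanSpace ℝ (Fin d) → EuclideanSpace ℝ (Fin d))
    (m M Lb LF ηs : ℝ) (hm : 0 < m) (hM : 0 ≤ M)
    (hcontr : ∀ x y : EuclideanSpace ℝ (Fin d), M ≤ ‖x - y‖ →
      ⟪x - y, b x - b y⟫ ≤ -m * ‖x - y‖ ^ 2)
    (hbLip : ∀ x y : EuclideanSpace ℝ (Fin d), ‖b x - b y‖ ≤ Lb * ‖x - y‖)
    (hFLip : ∀ x y : EuclideanSpace ℝ (Fin d), ‖F x - F y‖ ≤ LF * ‖x - y‖)
    (hFbdd : BddAbove (Set.range fun z => ‖F z‖))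
    (hηs : 0 < ηs) :
    ∀ Δt : ℝ, Δt ∈ Set.Ioo 0 (m / (2 * (Lb + ηs * LF) ^ 2)) →
      ∀ η : ℝ, |η| ≤ ηs →
        ∀ x xtil : EuclideanSpace ℝ (Fin d),
          max M (4 * ηs * (⨆ z, ‖F z‖) / m) ≤ ‖x - xtil‖ →
          ‖(x - xtil) + Δt • (b x - b xtil + η • (F x - F xtil))‖ ^ 2 ≤
            (1 - m * Δt / 4) ^ 2 * ‖x - xtil‖ ^ 2 := by
  rintro Δt ⟨hΔt, hΔt'⟩ η hη x xtil hx
  obtain ⟨hxM, hxK⟩ := max_le_iff.mp hx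
  set K : ℝ := ⨆ z, ‖F z‖
  have hFK : ‖F x - F xtil‖ ≤ 2 * K := by
    have h₁ : ‖F x‖ ≤ K := le_ciSup hFbdd x
    have h₂ : ‖F xtil‖ ≤ K := le_ciSup hFbdd xtil
    linarith [norm_sub_le (F x) (F xtil)]
  have hb := hcontr x xtil hxM
  have hbL := hbLip x xtil
  have hFL := hFLip x xtil
  set u := x - xtil
  set f := F x - F xtil
  set g := b x - b xtil
  have hηf : ‖η • f‖ ≤ ηs * ‖f‖ := by
    rw [norm_smul, Real.norm_eq_abs]
    gcongr
  have hinner : ⟪u, g + η • f⟫ ≤ -(m / 2) * ‖u‖ ^ 2 := by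
    have hF : ‖η • f‖ ≤ m / 2 * ‖u‖ := by
      rw [div_le_iff₀ hm] at hxK
      have := mul_le_mul_of_nonneg_left hFK hηs.le
      linarith
    have hcs := real_inner_le_norm u (η • f)
    have := mul_le_mul_of_nonneg_left hF (norm_nonneg u)
    rw [inner_add_right]
    linarith
  have hnorm : ‖g + η • f‖ ≤ (Lb + ηs * LF) * ‖u‖ := by
    have := mul_le_mul_of_nonneg_left hFL hηs.le
    linarith [norm_add_le g (η • f)]
  have hsq : ‖g + η • f‖ ^ 2 ≤ (Lb + ηs * LF) ^ 2 * ‖u‖ ^ 2 := by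
    rw [← mul_pow]
    gcongr
  have hstep : Δt * (Lb + ηs * LF) ^ 2 ≤ m / 2 := by
    have hL : 0 < 2 * (Lb + ηs * LF) ^ 2 :=
      (div_pos_iff_of_pos_left hm).mp (hΔt.trans hΔt')
    linarith [(lt_div_iff₀ hL).mp hΔt']
  calc ‖u + Δt • (g + η • f)‖ ^ 2
      = ‖u‖ ^ 2 + 2 * Δt * ⟪u, g + η • f⟫ + Δt ^ 2 * ‖g + η • f‖ ^ 2 := by
        rw [norm_add_sq_real, inner_smul_right, norm_smul, mul_pow, Real.norm_eq_abs, sq_abs]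
        ring
    _ ≤ ‖u‖ ^ 2 + 2 * Δt * (-(m / 2) * ‖u‖ ^ 2)
          + Δt ^ 2 * ((Lb + ηs * LF) ^ 2 * ‖u‖ ^ 2) := by gcongr
    _ = (1 - m * Δt + Δt * (Δt * (Lb + ηs * LF) ^ 2)) * ‖u‖ ^ 2 := by ring
    _ ≤ (1 - m * Δt + Δt * (m / 2)) * ‖u‖ ^ 2 := by gcongr
    _ ≤ (1 - m * Δt / 4) ^ 2 * ‖u‖ ^ 2 := by
        gcongr
        linarith [sq_nonneg (m * Δt)]
end

section
/- Define the continuous piecewise affine function τ : [0,∞) → [0,∞) by τ(r) = (1 + (L_b + η⋆L_F)Δt)·r for 0 ≤ r ≤ M̃, and τ(r) = (1 + (L_b + η⋆L_F)Δt)·M̃ + (1 − mΔt/4)(r − M̃) for r ≥ M̃. Then for every Δt ∈ (0, min{1/m, m/(2(L_b + η⋆L_F)²)}), every η with |η| ≤ η⋆, and all x, x̃ ∈ ℝ^d, one has |(x − x̃) + Δt·(b(x) − b(x̃) + η(F(x) − F(x̃)))| ≤ τ(|x − x̃|). -/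
open scoped RealInnerProductSpace

/-- An explicit Euler step along a direction `w` satisfying `⟪v, w⟫ ≤ -(m/2)‖v‖²` and
`‖w‖ ≤ L‖v‖` contracts by the factor `1 - m t / 4` when `t` is small. -/
theorem norm_add_smul_le_of_inner_le {E : Type*} [NormedAddCommGroup E] [InnerProductSpace ℝ E]
    {v w : E} {m L t : ℝ} (ht : 0 ≤ t) (hmt : m * t ≤ 1) (hLt : t * L ^ 2 ≤ m / 2)
    (hinner : ⟪v, w⟫ ≤ -(m / 2) * ‖v‖ ^ 2) (hw : ‖w‖ ≤ L * ‖v‖) :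
    ‖v + t • w‖ ≤ (1 - m * t / 4) * ‖v‖ := by
  have hw2 : ‖w‖ ^ 2 ≤ (L * ‖v‖) ^ 2 := pow_le_pow_left₀ (norm_nonneg w) hw 2
  refine le_of_abs_le (abs_le_of_sq_le_sq ?_ (mul_nonneg (by linarith) (norm_nonneg v)))
  calc ‖v + t • w‖ ^ 2 = ‖v‖ ^ 2 + 2 * t * ⟪v, w⟫ + t ^ 2 * ‖w‖ ^ 2 := by
        rw [norm_add_sq_real, inner_smul_right, norm_smul, mul_pow, Real.norm_eq_abs, sq_abs]
        ring
    _ ≤ ‖v‖ ^ 2 + 2 * t * (-(m / 2) * ‖v‖ ^ 2) + t ^ 2 * (L * ‖v‖) ^ 2 := by gcongr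
    _ = ‖v‖ ^ 2 - t * m * ‖v‖ ^ 2 + t * ‖v‖ ^ 2 * (t * L ^ 2) := by ring
    _ ≤ ‖v‖ ^ 2 - t * m * ‖v‖ ^ 2 + t * ‖v‖ ^ 2 * (m / 2) := by gcongr
    _ ≤ ((1 - m * t / 4) * ‖v‖) ^ 2 := by nlinarith [sq_nonneg (m * t * ‖v‖)]

/-- Drift control for the discretized coupled dynamics: the one-step Euler–Maruyama
displacement is bounded by the continuous piecewise affine function
`τ(r) = (1 + (L_b + η⋆ L_F)Δt) r` for `r ≤ M̃`, and
`τ(r) = (1 + (L_b + η⋆ L_F)Δt) M̃ + (1 − m Δt/4)(r − M̃)` for `r ≥ M̃`,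
where `M̃ = max{M, 4 η⋆ ‖F‖∞ / m}`. -/
theorem euler_maruyama_drift_control {d : ℕ}
    (b F : EuclideanSpace ℝ (Fin d) → EuclideanSpace ℝ (Fin d))
    (m M Lb LF ηs : ℝ) (hm : 0 < m) (hM : 0 ≤ M)
    (hcontr : ∀ x y : EuclideanSpace ℝ (Fin d), M ≤ ‖x - y‖ →
      ⟪x - y, b x - b y⟫ ≤ -m * ‖x - y‖ ^ 2)
    (hbLip : ∀ x y : EuclideanSpace ℝ (Fin d), ‖b x - b y‖ ≤ Lb * ‖x - y‖)
    (hFLip : ∀ x y : EuclideanSpace ℝ (Fin d), ‖F x - F y‖ ≤ LF * ‖x - y‖)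
    (hFbdd : BddAbove (Set.range fun z => ‖F z‖))
    (hηs : 0 < ηs) :
    ∀ Δt : ℝ, Δt ∈ Set.Ioo 0 (min (1/m) (m / (2 * (Lb + ηs * LF) ^ 2))) →
      ∀ η : ℝ, |η| ≤ ηs →
        ∀ x xtil : EuclideanSpace ℝ (Fin d),
          ‖(x - xtil) + Δt • (b x - b xtil + η • (F x - F xtil))‖ ≤
            (fun r : ℝ =>
              if r ≤ max M (4 * ηs * (⨆ z, ‖F z‖) / m) then
                (1 + (Lb + ηs * LF) * Δt) * r
              else
                (1 + (Lb + ηs * LF) * Δt) * max M (4 * ηs * (⨆ z, ‖F z‖) / m)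
                  + (1 - m * Δt / 4) * (r - max M (4 * ηs * (⨆ z, ‖F z‖) / m)))
              ‖x - xtil‖ := by
  rintro Δt ⟨ht0, ht⟩ η hη x y
  obtain ⟨ht1, ht2⟩ := lt_min_iff.mp ht
  set S := ⨆ z, ‖F z‖
  set R := max M (4 * ηs * S / m)
  set L := Lb + ηs * LF with hL
  have hFS : ∀ z, ‖F z‖ ≤ S := le_ciSup hFbdd
  have hw : ‖b x - b y + η • (F x - F y)‖ ≤ L * ‖x - y‖ := by
    calc ‖b x - b y + η • (F x - F y)‖ ≤ ‖b x - b y‖ + |η| * ‖F x - F y‖ := by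
          simpa only [norm_smul, Real.norm_eq_abs] using norm_add_le (b x - b y) (η • (F x - F y))
      _ ≤ Lb * ‖x - y‖ + ηs * (LF * ‖x - y‖) := by
          gcongr
          exacts [hbLip x y, hFLip x y]
      _ = L * ‖x - y‖ := by rw [hL]; ring
  dsimp only
  split_ifs with hr
  · calc ‖x - y + Δt • (b x - b y + η • (F x - F y))‖
        ≤ ‖x - y‖ + Δt * ‖b x - b y + η • (F x - F y)‖ := by
          simpa only [norm_smul, Real.norm_eq_abs, abs_of_pos ht0] using
            norm_add_le (x - y) (Δt • (b x - b y + η • (F x - F y)))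
      _ ≤ ‖x - y‖ + Δt * (L * ‖x - y‖) := by gcongr
      _ = (1 + L * Δt) * ‖x - y‖ := by ring
  · rw [not_le] at hr
    have hMR : M ≤ R := le_max_left _ _
    have hSR : 4 * ηs * S ≤ R * m := (div_le_iff₀ hm).mp (le_max_right _ _)
    have hR0 : 0 ≤ R := hM.trans hMR
    have hL0 : 0 ≤ L := nonneg_of_mul_nonneg_left ((norm_nonneg _).trans hw) (hR0.trans_lt hr)
    have hinnerF : η * ⟪x - y, F x - F y⟫ ≤ ηs * (‖x - y‖ * (S + S)) := by
      calc η * ⟪x - y, F x - F y⟫ ≤ |η| * |⟪x - y, F x - F y⟫| := by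
            rw [← abs_mul]; exact le_abs_self _
        _ ≤ ηs * (‖x - y‖ * ‖F x - F y‖) := by
            gcongr
            exact abs_real_inner_le_norm _ _
        _ ≤ ηs * (‖x - y‖ * (S + S)) := by
            gcongr
            exact (norm_sub_le _ _).trans (add_le_add (hFS x) (hFS y))
    have hinner : ⟪x - y, b x - b y + η • (F x - F y)⟫ ≤ -(m / 2) * ‖x - y‖ ^ 2 := by
      rw [inner_add_right, inner_smul_right]
      have hS : 4 * ηs * S ≤ ‖x - y‖ * m := hSR.trans (by gcongr)
      nlinarith [hcontr x y (hMR.trans hr.le), mul_le_mul_of_nonneg_left hS (norm_nonneg (x - y))]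
    have hmt : m * Δt ≤ 1 := by
      rw [lt_div_iff₀ hm] at ht1
      linarith
    have hLt : Δt * L ^ 2 ≤ m / 2 := by
      rcases hL0.eq_or_lt with h | h
      · rw [← h]
        linarith
      · rw [lt_div_iff₀ (by positivity)] at ht2
        linarith
    refine (norm_add_smul_le_of_inner_le ht0.le hmt hLt hinner hw).trans ?_
    have : 0 ≤ (L + m / 4) * Δt * R := by positivity
    linarith
end

section
/- For all r ≥ 0 one has the sandwich inequalities (φ(R₀)/2)·r ≤ Φ(r)/2 ≤ f(r) ≤ Φ(r) ≤ r. In particular, the distance d_f(x,y) = f(|x − y|) is equivalent to the Euclidean distance on ℝ^d. -/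
open MeasureTheory intervalIntegral

/-- The Eberle weight `φ(r) = exp(−(β/4)∫₀^r max{0, a − m s} ds)`. -/
noncomputable def eberlePhi (β a m r : ℝ) : ℝ :=
  Real.exp (-(β / 4) * ∫ s in (0:ℝ)..r, max 0 (a - m * s))

/-- `Φ(r) = ∫₀^r φ(s) ds`. -/
noncomputable def eberleCapPhi (β a m r : ℝ) : ℝ :=
  ∫ s in (0:ℝ)..r, eberlePhi β a m s

/-- `R₀ = a/m`. -/
noncomputable def eberleR0 (a m : ℝ) : ℝ := a / m

/-- `R₁ = a/m + 2/√m`. -/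
noncomputable def eberleR1 (a m : ℝ) : ℝ := a / m + 2 / Real.sqrt m

/-- `∫₀^{R₁} Φ(s)/φ(s) ds`. -/
noncomputable def eberleIntRatio (β a m : ℝ) : ℝ :=
  ∫ s in (0:ℝ)..(eberleR1 a m), eberleCapPhi β a m s / eberlePhi β a m s

/-- `∫₀^{R₁} φ(s)⁻¹ ds`. -/
noncomputable def eberleIntInv (β a m : ℝ) : ℝ :=
  ∫ s in (0:ℝ)..(eberleR1 a m), (eberlePhi β a m s)⁻¹

/-- The Eberle modulation function `g`. -/
noncomputable def eberleG (β a m r : ℝ) : ℝ :=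
  1 - (1 / 4) * (∫ s in (0:ℝ)..(min r (eberleR1 a m)),
        eberleCapPhi β a m s / eberlePhi β a m s) / eberleIntRatio β a m
    - (1 / 4) * (∫ s in (0:ℝ)..(min r (eberleR1 a m)),
        (eberlePhi β a m s)⁻¹) / eberleIntInv β a m

/-- The Eberle concave distance function `f(r) = ∫₀^r φ(s) g(s) ds`. -/
noncomputable def eberleF (β a m r : ℝ) : ℝ :=
  ∫ s in (0:ℝ)..r, eberlePhi β a m s * eberleG β a m s

/-- The contraction rate `c = min{1/β, 1/2} (∫₀^{R₁} Φ/φ)⁻¹`. -/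
noncomputable def eberleC (β a m : ℝ) : ℝ :=
  min (1 / β) (1 / 2) * (eberleIntRatio β a m)⁻¹

/-- The drift lower bound `ε = min{Φ(R₁)(2∫₀^{R₁} Φ/φ)⁻¹, (β∫₀^{R₁} φ⁻¹)⁻¹}`. -/
noncomputable def eberleEps (β a m : ℝ) : ℝ :=
  min (eberleCapPhi β a m (eberleR1 a m) * (2 * eberleIntRatio β a m)⁻¹)
    ((β * eberleIntInv β a m)⁻¹)

theorem continuous_eberlePhi (β a m : ℝ) : Continuous (eberlePhi β a m) := by
  have h : Continuous fun s : ℝ => max 0 (a - m * s) := by fun_prop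
  exact Real.continuous_exp.comp
    ((continuous_primitive (fun _ _ => h.intervalIntegrable _ _) 0).const_mul _)

theorem eberlePhi_pos (β a m r : ℝ) : 0 < eberlePhi β a m r := Real.exp_pos _

theorem continuous_eberleCapPhi (β a m : ℝ) : Continuous (eberleCapPhi β a m) :=
  continuous_primitive (fun _ _ => (continuous_eberlePhi β a m).intervalIntegrable _ _) 0

theorem eberleCapPhi_nonneg (β a m : ℝ) {r : ℝ} (hr : 0 ≤ r) : 0 ≤ eberleCapPhi β a m r :=
  integral_nonneg hr fun s _ => (eberlePhi_pos β a m s).le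

theorem continuous_inv_eberlePhi (β a m : ℝ) : Continuous fun s => (eberlePhi β a m s)⁻¹ :=
  (continuous_eberlePhi β a m).inv₀ fun s => (eberlePhi_pos β a m s).ne'

theorem continuous_eberleCapPhi_div_eberlePhi (β a m : ℝ) :
    Continuous fun s => eberleCapPhi β a m s / eberlePhi β a m s :=
  (continuous_eberleCapPhi β a m).div₀ (continuous_eberlePhi β a m)
    fun s => (eberlePhi_pos β a m s).ne'

theorem eberlePhi_le_one {β a m r : ℝ} (hβ : 0 ≤ β) (hr : 0 ≤ r) : eberlePhi β a m r ≤ 1 := by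
  have h : 0 ≤ ∫ s in (0:ℝ)..r, max 0 (a - m * s) :=
    integral_nonneg hr fun s _ => le_max_left _ _
  exact Real.exp_le_one_iff.2 (by nlinarith)

/-- The weight attains its minimum at `R₀`. -/
theorem eberlePhi_eberleR0_le {β a m : ℝ} (hm : 0 < m) (hβ : 0 ≤ β) (r : ℝ) :
    eberlePhi β a m (eberleR0 a m) ≤ eberlePhi β a m r := by
  have hc : Continuous fun s : ℝ => max 0 (a - m * s) := by fun_prop
  have hi (x y : ℝ) : IntervalIntegrable (fun s : ℝ => max 0 (a - m * s)) volume x y :=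
    hc.intervalIntegrable x y
  have h : (∫ s in (0:ℝ)..r, max 0 (a - m * s)) ≤
      ∫ s in (0:ℝ)..(eberleR0 a m), max 0 (a - m * s) := by
    rw [← sub_nonneg, integral_interval_sub_left (hi _ _) (hi _ _)]
    rcases le_total r (eberleR0 a m) with hr | hr
    · exact integral_nonneg hr fun s _ => le_max_left _ _
    · have hz : (∫ s in r..(eberleR0 a m), max 0 (a - m * s)) = 0 := by
        refine integral_zero_ae (ae_of_all _ fun s hs => max_eq_left ?_)
        rw [Set.uIoc_of_ge hr] at hs
        have := (div_lt_iff₀ hm).1 hs.1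
        linarith
      exact hz.ge
  exact Real.exp_le_exp.2 (by nlinarith)

theorem integral_min_div_integral_mem_Icc {h : ℝ → ℝ} (hc : Continuous h)
    (h0 : ∀ s, 0 ≤ s → 0 ≤ h s) {r R : ℝ} (hr : 0 ≤ r) (hR : 0 ≤ R) :
    (∫ s in (0:ℝ)..(min r R), h s) / (∫ s in (0:ℝ)..R, h s) ∈ Set.Icc (0:ℝ) 1 := by
  have hu : 0 ≤ min r R := le_min hr hR
  have h1 : 0 ≤ ∫ s in (0:ℝ)..(min r R), h s := integral_nonneg hu fun s hs => h0 s hs.1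
  have h2 : 0 ≤ ∫ s in (min r R)..R, h s :=
    integral_nonneg (min_le_right r R) fun s hs => h0 s (hu.trans hs.1)
  have h3 := integral_add_adjacent_intervals (hc.intervalIntegrable (μ := volume) 0 (min r R))
    (hc.intervalIntegrable (min r R) R)
  exact ⟨div_nonneg h1 (by linarith), div_le_one_of_le₀ (by linarith) (by linarith)⟩

theorem continuous_eberleG (β a m : ℝ) : Continuous (eberleG β a m) := by
  have hp {h : ℝ → ℝ} (hc : Continuous h) :
      Continuous fun r => ∫ s in (0:ℝ)..(min r (eberleR1 a m)), h s :=
    (continuous_primitive (fun _ _ => hc.intervalIntegrable _ _) 0).comp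
      (continuous_id.min continuous_const)
  exact (continuous_const.sub
    (((hp (continuous_eberleCapPhi_div_eberlePhi β a m)).const_mul _).div_const _)).sub
    (((hp (continuous_inv_eberlePhi β a m)).const_mul _).div_const _)

theorem eberleG_mem_Icc {β a m r : ℝ} (hm : 0 ≤ m) (ha : 0 ≤ a) (hr : 0 ≤ r) :
    eberleG β a m r ∈ Set.Icc (1 / 2 : ℝ) 1 := by
  have hR : 0 ≤ eberleR1 a m := by unfold eberleR1; positivity
  have h1 := integral_min_div_integral_mem_Icc (continuous_eberleCapPhi_div_eberlePhi β a m)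
    (fun s hs => div_nonneg (eberleCapPhi_nonneg β a m hs) (eberlePhi_pos β a m s).le) hr hR
  have h2 := integral_min_div_integral_mem_Icc (continuous_inv_eberlePhi β a m)
    (fun s _ => (inv_pos.2 (eberlePhi_pos β a m s)).le) hr hR
  simp only [Set.mem_Icc] at h1 h2
  simp only [eberleG, eberleIntRatio, eberleIntInv, mul_div_assoc, Set.mem_Icc]
  constructor <;> linarith [h1.1, h1.2, h2.1, h2.2]

/-- Sandwich inequalities `(φ(R₀)/2) r ≤ Φ(r)/2 ≤ f(r) ≤ Φ(r) ≤ r` for `r ≥ 0`; in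
particular the induced distance `d_f(x,y) = f(‖x − y‖)` is equivalent to the Euclidean
distance. -/
theorem eberleF_sandwich (m β a : ℝ) (hm : 0 < m) (hβ : 0 < β) (ha : 0 ≤ a) :
    (∀ r : ℝ, 0 ≤ r →
      eberlePhi β a m (eberleR0 a m) / 2 * r ≤ eberleCapPhi β a m r / 2 ∧
      eberleCapPhi β a m r / 2 ≤ eberleF β a m r ∧
      eberleF β a m r ≤ eberleCapPhi β a m r ∧
      eberleCapPhi β a m r ≤ r) ∧
    ∀ (d : ℕ) (x y : EuclideanSpace ℝ (Fin d)),
      eberlePhi β a m (eberleR0 a m) / 2 * ‖x - y‖ ≤ eberleF β a m ‖x - y‖ ∧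
      eberleF β a m ‖x - y‖ ≤ ‖x - y‖ := by
  have main (r : ℝ) (hr : 0 ≤ r) :
      eberlePhi β a m (eberleR0 a m) / 2 * r ≤ eberleCapPhi β a m r / 2 ∧
      eberleCapPhi β a m r / 2 ≤ eberleF β a m r ∧
      eberleF β a m r ≤ eberleCapPhi β a m r ∧
      eberleCapPhi β a m r ≤ r := by
    have hφ : IntervalIntegrable (eberlePhi β a m) volume 0 r :=
      (continuous_eberlePhi β a m).intervalIntegrable _ _
    have hφg : IntervalIntegrable (fun s => eberlePhi β a m s * eberleG β a m s) volume 0 r :=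
      ((continuous_eberlePhi β a m).mul (continuous_eberleG β a m)).intervalIntegrable _ _
    refine ⟨?_, ?_, ?_, ?_⟩
    · have h := integral_mono_on hr intervalIntegrable_const hφ
        fun s _ => eberlePhi_eberleR0_le (a := a) hm hβ.le s
      rw [intervalIntegral.integral_const, smul_eq_mul, sub_zero] at h
      unfold eberleCapPhi
      linarith
    · rw [eberleCapPhi, ← intervalIntegral.integral_div]
      refine integral_mono_on hr (hφ.div_const 2) hφg fun s hs => ?_
      have := mul_le_mul_of_nonneg_left (eberleG_mem_Icc (β := β) hm.le ha hs.1).1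
        (eberlePhi_pos β a m s).le
      linarith
    · exact integral_mono_on hr hφg hφ fun s hs =>
        mul_le_of_le_one_right (eberlePhi_pos β a m s).le (eberleG_mem_Icc hm.le ha hs.1).2
    · have h := integral_mono_on hr hφ intervalIntegrable_const
        fun s hs => eberlePhi_le_one (a := a) (m := m) hβ.le hs.1
      rw [intervalIntegral.integral_const, smul_eq_mul, sub_zero, mul_one] at h
      exact h
  refine ⟨main, fun d x y => ?_⟩
  obtain ⟨h1, h2, h3, h4⟩ := main ‖x - y‖ (norm_nonneg _)
  exact ⟨h1.trans h2, h3.trans h4⟩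
end
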